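/- arXiv:2101.04302 — 2 statements merged into one kernel-verified Lean document; each statement's English description precedes it below -/
import Mathlib

section
/- Let η : [0,∞) → ℝ² be a twice continuously differentiable solution of the expander ODE η''(s)/‖η'(s)‖² + s·η'(s) − η(s) = 0 with η'(s) ≠ 0 for every s ≥ 0. Then there exists a constant c > 0 such that ‖η'(s)‖ ≥ c for all s ≥ 0. -/
open Set

section Expander

variable {F : Type*} [NormedAddCommGroup F] [InnerProductSpace ℝ F]

theorem hasDerivWithinAt_norm_inv {f : ℝ → F} {f' : F} {S : Set ℝ} {s : ℝ}
    (hf : HasDerivWithinAt f f' S s) (h0 : f s ≠ 0) :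
    HasDerivWithinAt (fun t => ‖f t‖⁻¹) (-(inner ℝ (f s) f' / ‖f s‖ ^ 3)) S s := by
  have hn : 0 < ‖f s‖ := norm_pos_iff.2 h0
  have h := (hf.norm_sq.sqrt (by positivity)).fun_inv (by simpa using h0)
  simp only [Real.sqrt_sq (norm_nonneg _)] at h
  refine h.congr_deriv ?_
  field_simp

theorem exp_neg_norm_sq_le_of_inner (x k : F) :
    Real.exp (-(‖x‖ ^ 2 / 2)) ≤ 2 * (1 + ‖k‖ ^ 2) * (1 / (1 + inner ℝ x k ^ 2)) := by
  have h1 : inner ℝ x k ^ 2 ≤ ‖x‖ ^ 2 * ‖k‖ ^ 2 := by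
    rw [← mul_pow, ← sq_abs (inner ℝ x k)]
    gcongr
    exact abs_real_inner_le_norm x k
  have h2 := Real.add_one_le_exp (‖x‖ ^ 2 / 2)
  rw [Real.exp_neg, mul_one_div, inv_eq_one_div, div_le_div_iff₀ (Real.exp_pos _) (by positivity)]
  nlinarith [sq_nonneg ‖x‖, sq_nonneg ‖k‖,
    mul_le_mul_of_nonneg_left h2 (by positivity : 0 ≤ 2 * (1 + ‖k‖ ^ 2))]

variable {η η' η'' : ℝ → F}

/-- The vector `η - s η'`, rescaled by `exp (‖η‖² / 2) / ‖η'‖`, is conserved along an expander. -/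
theorem expander_exists_conserved
    (hderiv1 : ∀ s ∈ Ici (0 : ℝ), HasDerivWithinAt η (η' s) (Ici 0) s)
    (hderiv2 : ∀ s ∈ Ici (0 : ℝ), HasDerivWithinAt η' (η'' s) (Ici 0) s)
    (hreg : ∀ s ∈ Ici (0 : ℝ), η' s ≠ 0)
    (hode : ∀ s ∈ Ici (0 : ℝ), η'' s = ‖η' s‖ ^ 2 • (η s - s • η' s)) :
    ∃ k : F, ∀ s ∈ Ici (0 : ℝ),
      η s - s • η' s = (‖η' s‖ * Real.exp (-(‖η s‖ ^ 2 / 2))) • k := by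
  let Φ : ℝ → F := fun s => (‖η' s‖⁻¹ * Real.exp (‖η s‖ ^ 2 / 2)) • (η s - s • η' s)
  have hΦ : ∀ s ∈ Ici (0 : ℝ), HasDerivWithinAt Φ 0 (Ici 0) s := by
    intro s hs
    have hn : 0 < ‖η' s‖ := norm_pos_iff.2 (hreg s hs)
    have h1 := (hasDerivWithinAt_norm_inv (hderiv2 s hs) (hreg s hs)).mul
      (((hderiv1 s hs).norm_sq.div_const 2).exp)
    have h2 := (hderiv1 s hs).sub ((hasDerivWithinAt_id s (Ici 0)).smul (hderiv2 s hs))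
    have h3 := h1.smul h2
    refine h3.congr_deriv ?_
    have hu : η' s - (id s • η'' s + (1 : ℝ) • η' s)
        = (-(s * ‖η' s‖ ^ 2)) • (η s - s • η' s) := by
      rw [hode s hs]
      simp only [id]
      module
    have hi : inner ℝ (η' s) (η'' s)
        = ‖η' s‖ ^ 2 * (inner ℝ (η s) (η' s) - s * ‖η' s‖ ^ 2) := by
      rw [hode s hs, inner_smul_right, inner_sub_right, inner_smul_right,
        real_inner_self_eq_norm_sq, real_inner_comm]
    rw [hu, hi]
    simp only [Pi.mul_apply, Pi.sub_apply, Pi.smul_apply', id]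
    rw [smul_smul, ← add_smul]
    convert zero_smul ℝ _
    field_simp
    ring
  refine ⟨Φ 0, fun s hs => ?_⟩
  have hc : Φ s = Φ 0 := by
    refine constant_of_has_deriv_right_zero (a := 0) (b := s) (fun t ht => ?_) (fun t ht => ?_) s
      ⟨hs, le_rfl⟩
    · exact ((hΦ t ht.1).continuousWithinAt).mono Icc_subset_Ici_self
    · exact (hΦ t ht.1).mono (Ici_subset_Ici.2 ht.1)
  have hn : ‖η' s‖ ≠ 0 := norm_ne_zero_iff.2 (hreg s hs)
  rw [← hc]
  simp only [Φ]
  rw [smul_smul, Real.exp_neg]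
  convert (one_smul ℝ _).symm using 2
  field_simp

theorem antitoneOn_Ici_of_hasDerivWithinAt_nonpos {f f' : ℝ → ℝ} {a t : ℝ} (hat : a ≤ t)
    (hf : ∀ s ∈ Ici a, HasDerivWithinAt f (f' s) (Ici a) s) (hf' : ∀ s ∈ Ici t, f' s ≤ 0) :
    AntitoneOn f (Ici t) := by
  have hsub : Ici t ⊆ Ici a := Ici_subset_Ici.2 hat
  refine antitoneOn_of_hasDerivWithinAt_nonpos (convex_Ici t)
    (fun s hs => (hf s (hsub hs)).continuousWithinAt.mono hsub) (f' := f')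
    (fun s hs => (hf s (hsub (interior_subset hs))).mono (interior_subset.trans hsub))
    (fun s hs => hf' s (interior_subset hs))

theorem expander_exists_le_norm
    (hderiv1 : ∀ s ∈ Ici (0 : ℝ), HasDerivWithinAt η (η' s) (Ici 0) s)
    (hderiv2 : ∀ s ∈ Ici (0 : ℝ), HasDerivWithinAt η' (η'' s) (Ici 0) s)
    (hreg : ∀ s ∈ Ici (0 : ℝ), η' s ≠ 0)
    (hode : ∀ s ∈ Ici (0 : ℝ), η'' s = ‖η' s‖ ^ 2 • (η s - s • η' s)) :
    ∃ c : ℝ, 0 < c ∧ ∀ s ∈ Ici (0 : ℝ), c ≤ ‖η' s‖ := by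
  have hpos : ∀ s ∈ Ici (0 : ℝ), 0 < ‖η' s‖ := fun s hs => norm_pos_iff.2 (hreg s hs)
  obtain ⟨k, hk⟩ := expander_exists_conserved hderiv1 hderiv2 hreg hode
  have hp : ∀ s ∈ Ici (0 : ℝ), HasDerivWithinAt (fun t => ‖η' t‖⁻¹)
      (-(inner ℝ (η' s) k * Real.exp (-(‖η s‖ ^ 2 / 2)))) (Ici 0) s := by
    intro s hs
    have hn := hpos s hs
    refine (hasDerivWithinAt_norm_inv (hderiv2 s hs) (hreg s hs)).congr_deriv ?_
    rw [hode s hs, hk s hs, inner_smul_right, inner_smul_right]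
    field_simp
  by_cases hsign : ∃ t ∈ Ici (0 : ℝ), 0 ≤ inner ℝ (η' t) k
  · obtain ⟨t, ht, htk⟩ := hsign
    have hmono : MonotoneOn (fun s => inner ℝ (η' s) k) (Ici 0) := by
      have h : ∀ s ∈ Ici (0 : ℝ), HasDerivWithinAt (fun s => -inner ℝ (η' s) k)
          (-inner ℝ (η'' s) k) (Ici 0) s := fun s hs => by
        simpa using ((hderiv2 s hs).inner ℝ (hasDerivWithinAt_const s (Ici 0) k)).fun_neg
      have := antitoneOn_Ici_of_hasDerivWithinAt_nonpos le_rfl h fun s hs => by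
        rw [hode s hs, hk s hs, inner_smul_left, inner_smul_left, real_inner_self_eq_norm_sq,
          neg_nonpos]
        simp only [conj_trivial]
        positivity
      exact fun x hx y hy hxy => neg_le_neg_iff.1 (this hx hy hxy)
    have hanti := antitoneOn_Ici_of_hasDerivWithinAt_nonpos ht hp fun s hs => by
      have : 0 ≤ inner ℝ (η' s) k := htk.trans (hmono ht (mem_Ici.2 (le_trans ht hs)) hs)
      rw [neg_nonpos]
      positivity
    have hcont : ContinuousOn (fun s => ‖η' s‖) (Icc 0 t) := fun s hs =>
      ((hderiv2 s hs.1).continuousWithinAt.mono Icc_subset_Ici_self).norm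
    obtain ⟨m, hm, hmin⟩ := isCompact_Icc.exists_isMinOn (nonempty_Icc.2 ht) hcont
    refine ⟨‖η' m‖, hpos m hm.1, fun s hs => ?_⟩
    rcases le_total s t with hst | hst
    · exact hmin ⟨hs, hst⟩
    · exact (hmin ⟨ht, le_rfl⟩).trans
        ((inv_le_inv₀ (hpos s hs) (hpos t ht)).1 (hanti self_mem_Ici hst hst))
  · push Not at hsign
    have hq : ∀ s ∈ Ici (0 : ℝ), HasDerivWithinAt
        (fun t => ‖η' t‖⁻¹ + 2 * (1 + ‖k‖ ^ 2) * Real.arctan (inner ℝ (η t) k))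
        (-(inner ℝ (η' s) k * Real.exp (-(‖η s‖ ^ 2 / 2))) +
          2 * (1 + ‖k‖ ^ 2) * (1 / (1 + inner ℝ (η s) k ^ 2) * inner ℝ (η' s) k)) (Ici 0) s := by
      intro s hs
      have hy : HasDerivWithinAt (fun t => inner ℝ (η t) k) (inner ℝ (η' s) k) (Ici 0) s := by
        simpa using (hderiv1 s hs).inner ℝ (hasDerivWithinAt_const s (Ici 0) k)
      exact (hp s hs).add (hy.arctan.const_mul _)
    have hanti := antitoneOn_Ici_of_hasDerivWithinAt_nonpos le_rfl hq fun s hs => by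
      nlinarith [mul_le_mul_of_nonpos_left (exp_neg_norm_sq_le_of_inner (η s) k) (hsign s hs).le]
    have h0 := hpos 0 self_mem_Ici
    have hπ := Real.pi_pos
    refine ⟨(‖η' 0‖⁻¹ + 2 * (1 + ‖k‖ ^ 2) * Real.pi)⁻¹, by positivity, fun s hs => ?_⟩
    have h := hanti self_mem_Ici hs hs
    have hdiff : Real.arctan (inner ℝ (η 0) k) - Real.arctan (inner ℝ (η s) k) ≤ Real.pi := by
      linarith [Real.arctan_lt_pi_div_two (inner ℝ (η 0) k),
        Real.neg_pi_div_two_lt_arctan (inner ℝ (η s) k)]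
    have hmul := mul_le_mul_of_nonneg_left hdiff (by positivity : 0 ≤ 2 * (1 + ‖k‖ ^ 2))
    refine inv_le_of_inv_le₀ (hpos s hs) ?_
    dsimp only at h
    linarith

end Expander

/-- A solution of the expander ODE with nonvanishing derivative has speed
uniformly bounded below: `‖η'(s)‖ ≥ c > 0` for all `s ≥ 0`. -/
theorem expander_speed_lower_bound
    (η η' η'' : ℝ → EuclideanSpace ℝ (Fin 2))
    (hderiv1 : ∀ s ∈ Ici (0:ℝ), HasDerivWithinAt η (η' s) (Ici 0) s)
    (hderiv2 : ∀ s ∈ Ici (0:ℝ), HasDerivWithinAt η' (η'' s) (Ici 0) s)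
    (hcont : ContinuousOn η'' (Ici 0))
    (hreg : ∀ s ∈ Ici (0:ℝ), η' s ≠ 0)
    (hode : ∀ s ∈ Ici (0:ℝ),
      (‖η' s‖ ^ 2)⁻¹ • η'' s + s • η' s - η s = 0) :
    ∃ c : ℝ, 0 < c ∧ ∀ s ∈ Ici (0:ℝ), c ≤ ‖η' s‖ := by
  refine expander_exists_le_norm hderiv1 hderiv2 hreg fun s hs => ?_
  have hn : ‖η' s‖ ^ 2 ≠ 0 := pow_ne_zero 2 (norm_ne_zero_iff.2 (hreg s hs))
  rw [← eq_sub_of_add_eq (sub_eq_zero.1 (hode s hs)), smul_inv_smul₀ hn]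
end

section
/- There exist absolute constants C > 0 and N₀ ≥ 1 with the following property. Let u : ℝ² → ℝ be smooth with compact support contained in {(τ,s) : τ > 0 and s > 1}, let N ≥ N₀ be real, and define h(τ,s) = τ^{−2}·( τ·∂_τ u − ∂²_s u − s·∂_s u + N·u )(τ,s) on {τ > 0}. Then N·∬ s²·u² dτ ds + ∬ s²·(∂_s u)² dτ ds ≤ C·∬ s²·τ⁴·h² dτ ds, where all integrals are over (0,∞)×(1,∞). -/
open Set MeasureTheory

/-- Partial derivative in the first variable. -/
noncomputable def pd1 (u : ℝ × ℝ → ℝ) (p : ℝ × ℝ) : ℝ :=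
  deriv (fun t => u (t, p.2)) p.1

/-- Partial derivative in the second variable. -/
noncomputable def pd2 (u : ℝ × ℝ → ℝ) (p : ℝ × ℝ) : ℝ :=
  deriv (fun s => u (p.1, s)) p.2

lemma hasDerivAt_pd1 {u : ℝ × ℝ → ℝ} (hu : Differentiable ℝ u) (p : ℝ × ℝ) :
    HasDerivAt (fun t => u (t, p.2)) (pd1 u p) p.1 := by
  have h : Differentiable ℝ (fun t => u (t, p.2)) := by fun_prop
  exact (h p.1).hasDerivAt

lemma hasDerivAt_pd2 {u : ℝ × ℝ → ℝ} (hu : Differentiable ℝ u) (p : ℝ × ℝ) :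
    HasDerivAt (fun s => u (p.1, s)) (pd2 u p) p.2 := by
  have h : Differentiable ℝ (fun s => u (p.1, s)) := by fun_prop
  exact (h p.2).hasDerivAt

lemma pd1_eq_fderiv {u : ℝ × ℝ → ℝ} (hu : Differentiable ℝ u) :
    pd1 u = fun p => fderiv ℝ u p (1, 0) := by
  ext p
  refine (hasDerivAt_pd1 hu p).unique ?_
  exact (hu p).hasFDerivAt.comp_hasDerivAt p.1
    ((hasDerivAt_id p.1).prodMk (hasDerivAt_const p.1 p.2))

lemma pd2_eq_fderiv {u : ℝ × ℝ → ℝ} (hu : Differentiable ℝ u) :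
    pd2 u = fun p => fderiv ℝ u p (0, 1) := by
  ext p
  refine (hasDerivAt_pd2 hu p).unique ?_
  exact (hu p).hasFDerivAt.comp_hasDerivAt p.2
    ((hasDerivAt_const p.2 p.1).prodMk (hasDerivAt_id p.2))

lemma contDiff_fderiv_apply_const {u : ℝ × ℝ → ℝ} (hu : ContDiff ℝ (⊤ : ℕ∞) u) (v : ℝ × ℝ) :
    ContDiff ℝ (⊤ : ℕ∞) (fun p => fderiv ℝ u p v) :=
  (hu.fderiv_right (by norm_cast)).clm_apply contDiff_const

lemma contDiff_pd1 {u : ℝ × ℝ → ℝ} (hu : ContDiff ℝ (⊤ : ℕ∞) u) :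
    ContDiff ℝ (⊤ : ℕ∞) (pd1 u) := by
  rw [pd1_eq_fderiv (hu.differentiable (by simp))]
  exact contDiff_fderiv_apply_const hu _

lemma contDiff_pd2 {u : ℝ × ℝ → ℝ} (hu : ContDiff ℝ (⊤ : ℕ∞) u) :
    ContDiff ℝ (⊤ : ℕ∞) (pd2 u) := by
  rw [pd2_eq_fderiv (hu.differentiable (by simp))]
  exact contDiff_fderiv_apply_const hu _

lemma fderiv_apply_eq_zero_of_notMem_tsupport {u : ℝ × ℝ → ℝ} {p : ℝ × ℝ}
    (hp : p ∉ tsupport u) (v : ℝ × ℝ) : fderiv ℝ u p v = 0 := by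
  rw [Function.notMem_support.mp fun h => hp (support_fderiv_subset ℝ h)]
  rfl

lemma pd1_eq_zero_of_notMem_tsupport {u : ℝ × ℝ → ℝ} (hu : Differentiable ℝ u) {p : ℝ × ℝ}
    (hp : p ∉ tsupport u) : pd1 u p = 0 := by
  rw [pd1_eq_fderiv hu]
  exact fderiv_apply_eq_zero_of_notMem_tsupport hp _

lemma pd2_eq_zero_of_notMem_tsupport {u : ℝ × ℝ → ℝ} (hu : Differentiable ℝ u) {p : ℝ × ℝ}
    (hp : p ∉ tsupport u) : pd2 u p = 0 := by
  rw [pd2_eq_fderiv hu]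
  exact fderiv_apply_eq_zero_of_notMem_tsupport hp _

lemma tsupport_pd2_subset {u : ℝ × ℝ → ℝ} (hu : Differentiable ℝ u) :
    tsupport (pd2 u) ⊆ tsupport u :=
  closure_minimal
    (fun _ hp => by_contra fun h => hp (pd2_eq_zero_of_notMem_tsupport hu h))
    (isClosed_tsupport u)

lemma integrable_fderiv_apply_const {g : ℝ × ℝ → ℝ} (hg : ContDiff ℝ (⊤ : ℕ∞) g)
    (hc : HasCompactSupport g) (v : ℝ × ℝ) : Integrable (fun p => fderiv ℝ g p v) :=
  (contDiff_fderiv_apply_const hg v).continuous.integrable_of_hasCompactSupport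
    (hc.fderiv_apply ℝ v)

lemma integral_fderiv_apply_const_eq_zero {g : ℝ × ℝ → ℝ} (hg : ContDiff ℝ (⊤ : ℕ∞) g)
    (hc : HasCompactSupport g) (v : ℝ × ℝ) : ∫ p, fderiv ℝ g p v = 0 := by
  have h := integral_mul_fderiv_eq_neg_fderiv_mul_of_integrable (𝕜 := ℝ)
    (μ := (volume : Measure (ℝ × ℝ))) (f := fun _ => (1 : ℝ)) (g := g) (v := v)
    (by simp) (by simpa using integrable_fderiv_apply_const hg hc v)
    (by simpa using hg.continuous.integrable_of_hasCompactSupport hc)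
    (fun _ _ => differentiableAt_const _) (fun p _ => hg.differentiable (by simp) p)
  simpa using h

lemma integrable_pd1 {g : ℝ × ℝ → ℝ} (hg : ContDiff ℝ (⊤ : ℕ∞) g)
    (hc : HasCompactSupport g) : Integrable (pd1 g) := by
  rw [pd1_eq_fderiv (hg.differentiable (by simp))]
  exact integrable_fderiv_apply_const hg hc _

lemma integrable_pd2 {g : ℝ × ℝ → ℝ} (hg : ContDiff ℝ (⊤ : ℕ∞) g)
    (hc : HasCompactSupport g) : Integrable (pd2 g) := by
  rw [pd2_eq_fderiv (hg.differentiable (by simp))]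
  exact integrable_fderiv_apply_const hg hc _

lemma integral_pd1_eq_zero {g : ℝ × ℝ → ℝ} (hg : ContDiff ℝ (⊤ : ℕ∞) g)
    (hc : HasCompactSupport g) : ∫ p, pd1 g p = 0 := by
  rw [pd1_eq_fderiv (hg.differentiable (by simp))]
  exact integral_fderiv_apply_const_eq_zero hg hc _

lemma integral_pd2_eq_zero {g : ℝ × ℝ → ℝ} (hg : ContDiff ℝ (⊤ : ℕ∞) g)
    (hc : HasCompactSupport g) : ∫ p, pd2 g p = 0 := by
  rw [pd2_eq_fderiv (hg.differentiable (by simp))]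
  exact integral_fderiv_apply_const_eq_zero hg hc _

/-- The model operator `τ∂_τ − ∂²_s − s∂_s + N`. -/
noncomputable def modelOp (N : ℝ) (u : ℝ × ℝ → ℝ) (p : ℝ × ℝ) : ℝ :=
  p.1 * pd1 u p - pd2 (pd2 u) p - p.2 * pd2 u p + N * u p

lemma contDiff_modelOp (N : ℝ) {u : ℝ × ℝ → ℝ} (hu : ContDiff ℝ (⊤ : ℕ∞) u) :
    ContDiff ℝ (⊤ : ℕ∞) (modelOp N u) := by
  have h1 := contDiff_pd1 hu
  have h2 := contDiff_pd2 hu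
  have h3 := contDiff_pd2 h2
  unfold modelOp
  fun_prop

lemma modelOp_eq_zero_of_notMem_tsupport (N : ℝ) {u : ℝ × ℝ → ℝ}
    (hu : ContDiff ℝ (⊤ : ℕ∞) u) {p : ℝ × ℝ} (hp : p ∉ tsupport u) : modelOp N u p = 0 := by
  have hd := hu.differentiable (by simp)
  have hd2 := (contDiff_pd2 hu).differentiable (by simp)
  simp [modelOp, pd1_eq_zero_of_notMem_tsupport hd hp, pd2_eq_zero_of_notMem_tsupport hd hp,
    pd2_eq_zero_of_notMem_tsupport hd2 fun h => hp (tsupport_pd2_subset hd h),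
    image_eq_zero_of_notMem_tsupport hp]

/-- The first component of the flux in the weighted energy identity. -/
noncomputable def flux1 (u : ℝ × ℝ → ℝ) (p : ℝ × ℝ) : ℝ :=
  p.1 * p.2 ^ 2 * u p ^ 2 / 2

/-- The second component of the flux in the weighted energy identity. -/
noncomputable def flux2 (u : ℝ × ℝ → ℝ) (p : ℝ × ℝ) : ℝ :=
  -(p.2 ^ 2 * u p * pd2 u p) + p.2 * u p ^ 2 - p.2 ^ 3 * u p ^ 2 / 2

lemma contDiff_flux1 {u : ℝ × ℝ → ℝ} (hu : ContDiff ℝ (⊤ : ℕ∞) u) :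
    ContDiff ℝ (⊤ : ℕ∞) (flux1 u) := by
  unfold flux1
  fun_prop

lemma contDiff_flux2 {u : ℝ × ℝ → ℝ} (hu : ContDiff ℝ (⊤ : ℕ∞) u) :
    ContDiff ℝ (⊤ : ℕ∞) (flux2 u) := by
  have h2 := contDiff_pd2 hu
  unfold flux2
  fun_prop

lemma hasCompactSupport_flux1 {u : ℝ × ℝ → ℝ} (hc : HasCompactSupport u) :
    HasCompactSupport (flux1 u) :=
  .intro hc fun p hp => by simp [flux1, image_eq_zero_of_notMem_tsupport hp]

lemma hasCompactSupport_flux2 {u : ℝ × ℝ → ℝ} (hc : HasCompactSupport u) :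
    HasCompactSupport (flux2 u) :=
  .intro hc fun p hp => by simp [flux2, image_eq_zero_of_notMem_tsupport hp]

lemma pd1_flux1 {u : ℝ × ℝ → ℝ} (hu : Differentiable ℝ u) (p : ℝ × ℝ) :
    pd1 (flux1 u) p = p.2 ^ 2 * u p ^ 2 / 2 + p.1 * p.2 ^ 2 * u p * pd1 u p := by
  have h := ((((hasDerivAt_id p.1).mul_const (p.2 ^ 2)).mul
    ((hasDerivAt_pd1 hu p).pow 2)).div_const 2).deriv
  refine h.trans ?_
  simp
  ring

lemma pd2_flux2 {u : ℝ × ℝ → ℝ} (hu : ContDiff ℝ (⊤ : ℕ∞) u) (p : ℝ × ℝ) :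
    pd2 (flux2 u) p = -(p.2 ^ 2 * pd2 u p ^ 2) - p.2 ^ 2 * u p * pd2 (pd2 u) p + u p ^ 2
      - 3 / 2 * p.2 ^ 2 * u p ^ 2 - p.2 ^ 3 * u p * pd2 u p := by
  have hs := hasDerivAt_id p.2
  have hd := hasDerivAt_pd2 (hu.differentiable (by simp)) p
  have hd2 := hasDerivAt_pd2 ((contDiff_pd2 hu).differentiable (by simp)) p
  have h := (((((hs.pow 2).mul hd).mul hd2).neg.add (hs.mul (hd.pow 2))).sub
    (((hs.pow 3).mul (hd.pow 2)).div_const 2)).deriv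
  refine h.trans ?_
  simp
  ring

/-- The weighted energy identity in divergence form. -/
lemma weighted_energy_identity (N : ℝ) {u : ℝ × ℝ → ℝ} (hu : ContDiff ℝ (⊤ : ℕ∞) u)
    (p : ℝ × ℝ) :
    p.2 ^ 2 * u p * modelOp N u p =
      p.2 ^ 2 * pd2 u p ^ 2 + N * (p.2 ^ 2 * u p ^ 2) + (p.2 ^ 2 - 1) * u p ^ 2
        + pd1 (flux1 u) p + pd2 (flux2 u) p := by
  rw [pd1_flux1 (hu.differentiable (by simp)), pd2_flux2 hu, modelOp]
  ring

/-- Weighted energy estimate for the model operator `τ∂_τ − ∂²_s − s∂_s + N`: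
if `h = τ^{−2}(τ∂_τ u − ∂²_s u − s∂_s u + Nu)` for `u` smooth and compactly supported
in `{τ > 0, s > 1}` and `N ≥ N₀`, then
`N ∬ s²u² + ∬ s²(∂_s u)² ≤ C ∬ s²τ⁴h²`. -/
theorem model_energy_estimate_weighted :
    ∃ C : ℝ, 0 < C ∧ ∃ N₀ : ℝ, 1 ≤ N₀ ∧
      ∀ (u h : ℝ × ℝ → ℝ) (N : ℝ), N₀ ≤ N →
        ContDiff ℝ (⊤ : ℕ∞) u → HasCompactSupport u →
        tsupport u ⊆ {p : ℝ × ℝ | 0 < p.1 ∧ 1 < p.2} →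
        (∀ p : ℝ × ℝ, 0 < p.1 →
          h p = (p.1 ^ 2)⁻¹ *
            (p.1 * pd1 u p - pd2 (pd2 u) p - p.2 * pd2 u p + N * u p)) →
        N * (∫ p in Ioi (0:ℝ) ×ˢ Ioi (1:ℝ), p.2 ^ 2 * (u p) ^ 2) +
          (∫ p in Ioi (0:ℝ) ×ˢ Ioi (1:ℝ), p.2 ^ 2 * (pd2 u p) ^ 2) ≤
          C * ∫ p in Ioi (0:ℝ) ×ˢ Ioi (1:ℝ), p.2 ^ 2 * p.1 ^ 4 * (h p) ^ 2 := by
  refine ⟨1, one_pos, 1, le_rfl, fun u h N hN hu hc hsupp hh => ?_⟩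
  have hd := hu.differentiable (by simp)
  have h0 : ∀ p ∉ Ioi (0:ℝ) ×ˢ Ioi (1:ℝ), p ∉ tsupport u := fun p hp hpu => hp (hsupp hpu)
  have hrhs : ∫ p in Ioi (0:ℝ) ×ˢ Ioi (1:ℝ), p.2 ^ 2 * p.1 ^ 4 * (h p) ^ 2 =
      ∫ p in Ioi (0:ℝ) ×ˢ Ioi (1:ℝ), p.2 ^ 2 * modelOp N u p ^ 2 := by
    refine setIntegral_congr_fun (measurableSet_Ioi.prod measurableSet_Ioi) fun p hp => ?_
    have hp1 : p.1 ≠ 0 := ne_of_gt hp.1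
    change _ = p.2 ^ 2 * modelOp N u p ^ 2
    simp only [hh p hp.1, modelOp]
    field_simp
  rw [hrhs,
    setIntegral_eq_integral_of_forall_compl_eq_zero fun p hp => by
      simp [image_eq_zero_of_notMem_tsupport (h0 p hp)],
    setIntegral_eq_integral_of_forall_compl_eq_zero fun p hp => by
      simp [pd2_eq_zero_of_notMem_tsupport hd (h0 p hp)],
    setIntegral_eq_integral_of_forall_compl_eq_zero fun p hp => by
      simp [modelOp_eq_zero_of_notMem_tsupport N hu (h0 p hp)], one_mul]
  have hcu := hu.continuous
  have hc2 := (contDiff_pd2 hu).continuous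
  have hcm := (contDiff_modelOp N hu).continuous
  have iA : Integrable fun p : ℝ × ℝ => p.2 ^ 2 * u p ^ 2 :=
    Continuous.integrable_of_hasCompactSupport (by fun_prop)
      (.intro hc fun p hp => by simp [image_eq_zero_of_notMem_tsupport hp])
  have iB : Integrable fun p : ℝ × ℝ => p.2 ^ 2 * pd2 u p ^ 2 :=
    Continuous.integrable_of_hasCompactSupport (by fun_prop)
      (.intro hc fun p hp => by simp [pd2_eq_zero_of_notMem_tsupport hd hp])
  have iF : Integrable fun p : ℝ × ℝ => p.2 ^ 2 * modelOp N u p ^ 2 :=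
    Continuous.integrable_of_hasCompactSupport (by fun_prop)
      (.intro hc fun p hp => by simp [modelOp_eq_zero_of_notMem_tsupport N hu hp])
  have i1 := integrable_pd1 (contDiff_flux1 hu) (hasCompactSupport_flux1 hc)
  have i2 := integrable_pd2 (contDiff_flux2 hu) (hasCompactSupport_flux2 hc)
  have i12 : Integrable fun p => 2 * (pd1 (flux1 u) p + pd2 (flux2 u) p) :=
    (i1.add i2).const_mul 2
  have key : ∀ p : ℝ × ℝ, N * (p.2 ^ 2 * u p ^ 2) + p.2 ^ 2 * pd2 u p ^ 2 ≤
      p.2 ^ 2 * modelOp N u p ^ 2 - 2 * (pd1 (flux1 u) p + pd2 (flux2 u) p) := by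
    intro p
    have hid := weighted_energy_identity N hu p
    have hweight : 0 ≤ (p.2 ^ 2 - 1) * u p ^ 2 := by
      by_cases hp : p ∈ tsupport u
      · have hp2 : 1 < p.2 := (hsupp hp).2
        exact mul_nonneg (by nlinarith) (sq_nonneg _)
      · simp [image_eq_zero_of_notMem_tsupport hp]
    have hyoung : 0 ≤ p.2 ^ 2 * (u p - modelOp N u p) ^ 2 := by positivity
    have hgrad : 0 ≤ p.2 ^ 2 * pd2 u p ^ 2 := by positivity
    have hmass : 0 ≤ (N - 1) * (p.2 ^ 2 * u p ^ 2) :=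
      mul_nonneg (by linarith) (by positivity)
    linarith
  calc N * (∫ p : ℝ × ℝ, p.2 ^ 2 * u p ^ 2) + ∫ p : ℝ × ℝ, p.2 ^ 2 * pd2 u p ^ 2
      = ∫ p : ℝ × ℝ, (N * (p.2 ^ 2 * u p ^ 2) + p.2 ^ 2 * pd2 u p ^ 2) := by
        rw [integral_add (iA.const_mul N) iB, integral_const_mul]
    _ ≤ ∫ p : ℝ × ℝ, (p.2 ^ 2 * modelOp N u p ^ 2
          - 2 * (pd1 (flux1 u) p + pd2 (flux2 u) p)) :=
        integral_mono ((iA.const_mul N).add iB) (iF.sub i12) key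
    _ = ∫ p : ℝ × ℝ, p.2 ^ 2 * modelOp N u p ^ 2 := by
        rw [integral_sub iF i12, integral_const_mul, integral_add i1 i2,
          integral_pd1_eq_zero (contDiff_flux1 hu) (hasCompactSupport_flux1 hc),
          integral_pd2_eq_zero (contDiff_flux2 hu) (hasCompactSupport_flux2 hc)]
        ring
end
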